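/- Let 1 ≤ k ≤ n. The function λ ↦ log σ_k(λ) is concave on the Gårding cone Γ_k ⊂ ℝ^n; that is, for all λ, μ ∈ Γ_k and t ∈ [0,1], log σ_k(tλ + (1−t)μ) ≥ t log σ_k(λ) + (1−t) log σ_k(μ). (Here Γ_k is convex so tλ + (1−t)μ ∈ Γ_k.) -/

import Mathlib

open Finset

/-- The `k`-th elementary symmetric polynomial of the values of `lam` on the index set `S`. -/
noncomputable def esymmOn {n : ℕ} (S : Finset (Fin n)) (k : ℕ) (lam : Fin n → ℝ) : ℝ :=
  ∑ s ∈ S.powersetCard k, ∏ i ∈ s, lam i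

/-- The `k`-th elementary symmetric polynomial `σ_k` on `ℝ^n`. -/
noncomputable def sigmaK (n k : ℕ) (lam : Fin n → ℝ) : ℝ :=
  esymmOn (Finset.univ : Finset (Fin n)) k lam

/-- The Gårding cone `Γ_k = {λ : σ_1(λ) > 0, …, σ_k(λ) > 0}`. -/
def GardingCone (n k : ℕ) : Set (Fin n → ℝ) :=
  {lam | ∀ j, 1 ≤ j → j ≤ k → 0 < sigmaK n j lam}

lemma esymmOn_zero {n : ℕ} (S : Finset (Fin n)) (x : Fin n → ℝ) : esymmOn S 0 x = 1 := by
  simp [esymmOn]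

lemma esymmOn_insert {n : ℕ} (S : Finset (Fin n)) (a : Fin n) (ha : a ∉ S) (k : ℕ)
    (x : Fin n → ℝ) :
    esymmOn (insert a S) (k+1) x = esymmOn S (k+1) x + x a * esymmOn S k x := by
  unfold esymmOn
  rw [Finset.powersetCard_succ_insert ha, Finset.sum_union, Finset.sum_image, Finset.mul_sum]
  · congr 1
    apply Finset.sum_congr rfl
    intro t ht
    rw [Finset.prod_insert]
    intro h
    exact ha ((Finset.mem_powersetCard.1 ht).1 h)
  · intro s hs t ht hst
    have h1 : a ∉ s := fun h => ha ((Finset.mem_powersetCard.1 hs).1 h)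
    have h2 : a ∉ t := fun h => ha ((Finset.mem_powersetCard.1 ht).1 h)
    rw [← Finset.erase_insert h1, ← Finset.erase_insert h2]
    exact congrArg (fun u => Finset.erase u a) hst
  · rw [Finset.disjoint_left]
    intro s hs hs'
    obtain ⟨t, _, rfl⟩ := Finset.mem_image.1 hs'
    exact ha ((Finset.mem_powersetCard.1 hs).1 (Finset.mem_insert_self a t))

lemma esymmOn_erase {n : ℕ} (S : Finset (Fin n)) (a : Fin n) (ha : a ∈ S) (k : ℕ)
    (x : Fin n → ℝ) :
    esymmOn S (k+1) x = esymmOn (S.erase a) (k+1) x + x a * esymmOn (S.erase a) k x := by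
  rw [← esymmOn_insert _ a (Finset.notMem_erase a S), Finset.insert_erase ha]

lemma esymmOn_smul {n : ℕ} (S : Finset (Fin n)) (k : ℕ) (t : ℝ) (x : Fin n → ℝ) :
    esymmOn S k (t • x) = t ^ k * esymmOn S k x := by
  unfold esymmOn
  rw [Finset.mul_sum]
  apply Finset.sum_congr rfl
  intro s hs
  simp only [Pi.smul_apply, smul_eq_mul]
  rw [Finset.prod_mul_distrib, Finset.prod_const, (Finset.mem_powersetCard.1 hs).2]

lemma esymmOn_euler {n : ℕ} (x : Fin n → ℝ) (S : Finset (Fin n)) : ∀ (k : ℕ),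
    ∑ i ∈ S, x i * esymmOn (S.erase i) k x = (k+1) * esymmOn S (k+1) x := by
  induction S using Finset.induction_on with
  | empty =>
    intro k
    have : esymmOn (∅ : Finset (Fin n)) (k+1) x = 0 := by
      unfold esymmOn
      rw [Finset.powersetCard_eq_empty.2 (by simp)]
      simp
    simp [this]
  | insert a T ha ih =>
    intro k
    rw [Finset.sum_insert ha, Finset.erase_insert ha, esymmOn_insert T a ha]
    have he : ∀ i ∈ T, (insert a T).erase i = insert a (T.erase i) := by
      intro i hi
      rw [Finset.erase_insert_of_ne]
      rintro rfl
      exact ha hi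
    have hn : ∀ i, a ∉ T.erase i := fun i h => ha (Finset.mem_of_mem_erase h)
    cases k with
    | zero =>
      have h0 := ih 0
      simp only [esymmOn_zero] at h0 ⊢
      rw [h0]
      push_cast
      ring
    | succ m =>
      have h1 : ∑ i ∈ T, x i * esymmOn ((insert a T).erase i) (m+1) x
          = ∑ i ∈ T, x i * esymmOn (T.erase i) (m+1) x
            + x a * ∑ i ∈ T, x i * esymmOn (T.erase i) m x := by
        rw [Finset.mul_sum, ← Finset.sum_add_distrib]
        apply Finset.sum_congr rfl
        intro i hi
        rw [he i hi, esymmOn_insert _ a (hn i)]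
        ring
      rw [h1, ih, ih]
      push_cast
      ring

/-! Newton -/

open Polynomial in
lemma splits_derivative_real (p : ℝ[X]) (hp : p.Splits) : (derivative p).Splits := by
  by_cases h0 : derivative p = 0
  · rw [h0]; exact Polynomial.Splits.zero
  have h := Polynomial.card_roots_le_derivative p
  have h1 := hp.natDegree_eq_card_roots
  have h2 := Polynomial.natDegree_derivative_lt (p := p) (by
    intro h
    exact h0 (Polynomial.derivative_of_natDegree_zero h))
  have h3 := Polynomial.card_roots' (derivative p)
  exact Polynomial.splits_iff_card_roots.2 (by omega)

open Polynomial in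
lemma laguerre (s : Multiset ℝ) (c x : ℝ) :
    let p := C c * (s.map (fun r => X - C r)).prod
    0 ≤ (derivative p).eval x ^ 2 - p.eval x * (derivative (derivative p)).eval x := by
  intro p
  induction s using Multiset.induction_on with
  | empty => simp [p]
  | cons a s ih =>
    set q := C c * (s.map (fun r => X - C r)).prod with hq
    have hp : p = (X - C a) * q := by
      simp only [p, hq, Multiset.map_cons, Multiset.prod_cons]; ring
    rw [hp]
    simp only [derivative_mul, derivative_add, derivative_sub, derivative_X, derivative_C,
      eval_mul, eval_add, eval_sub, eval_X, eval_C, sub_zero, one_mul, derivative_one, eval_one]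
    have := mul_nonneg (sq_nonneg (x - a)) ih
    nlinarith [sq_nonneg (q.eval x)]

open Polynomial in
lemma newton_coeff (m : ℕ) : ∀ (p : ℝ[X]), p.Splits →
    ((m:ℝ)+2) * (p.coeff m * p.coeff (m+2)) ≤ (m+1) * p.coeff (m+1) ^ 2 := by
  induction m with
  | zero =>
    intro p hp
    have h := laguerre p.roots p.leadingCoeff 0
    rw [← hp.eq_prod_roots] at h
    simp only [← coeff_zero_eq_eval_zero, coeff_derivative] at h
    norm_num at h ⊢
    linarith
  | succ m ih =>
    intro p hp
    have h := ih _ (splits_derivative_real p hp)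
    simp only [coeff_derivative] at h
    push_cast at h ⊢
    have hm : (0:ℝ) < ((m:ℝ)+1) * (m+2) := by positivity
    refine le_of_mul_le_mul_left ?_ hm
    ring_nf at h ⊢
    linarith

open Polynomial in
lemma newton_esymm {n : ℕ} (S : Finset (Fin n)) (x : Fin n → ℝ) (m : ℕ) :
    esymmOn S m x * esymmOn S (m+2) x ≤ esymmOn S (m+1) x ^ 2 := by
  have hc : ∀ (T : Finset (Fin n)) (j : ℕ),
      (∏ i ∈ T, (C (x i) * X + C 1 : ℝ[X])).coeff j = esymmOn T j x := by
    intro T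
    induction T using Finset.induction_on with
    | empty =>
      intro j
      cases j with
      | zero => simp [esymmOn_zero]
      | succ k =>
        unfold esymmOn
        rw [Finset.powersetCard_eq_empty.2 (by simp)]
        simp [Polynomial.coeff_one]
    | insert a T ha ih =>
      intro j
      rw [Finset.prod_insert ha, add_mul, mul_assoc, coeff_add, coeff_C_mul, coeff_C_mul, ih]
      cases j with
      | zero => simp [esymmOn_zero]
      | succ k => rw [coeff_X_mul, ih, esymmOn_insert T a ha]; ring
  have hs : (∏ i ∈ S, (C (x i) * X + C 1 : ℝ[X])).Splits := by
    apply Polynomial.Splits.prod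
    intro i _
    apply Polynomial.Splits.of_degree_le_one
    exact Polynomial.degree_linear_le
  have h := newton_coeff m _ hs
  rw [hc, hc, hc] at h
  have h2 := sq_nonneg (esymmOn S (m+1) x)
  by_contra hlt
  push Not at hlt
  have hm : (0:ℝ) ≤ m := Nat.cast_nonneg m
  nlinarith

def coneOn {n : ℕ} (S : Finset (Fin n)) (k : ℕ) (x : Fin n → ℝ) : Prop :=
  ∀ j, j ≤ k → 0 < esymmOn S j x

lemma coneOn_erase {n : ℕ} (S : Finset (Fin n)) (a : Fin n) (ha : a ∈ S) (x : Fin n → ℝ)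
    (k : ℕ) (h : coneOn S (k+1) x) : coneOn (S.erase a) k x := by
  induction k with
  | zero =>
    intro j hj
    obtain rfl : j = 0 := by omega
    simp [esymmOn_zero]
  | succ k ih =>
    have ih' := ih (fun j hj => h j (by omega))
    intro j hj
    rcases Nat.lt_or_ge j (k+1) with hj' | hj'
    · exact ih' j (by omega)
    obtain rfl : j = k+1 := by omega
    have h0 := ih' k le_rfl
    have h1 := h (k+1) (by omega)
    have h2 := h (k+2) (by omega)
    rw [esymmOn_erase S a ha] at h1 h2
    have hN := newton_esymm (S.erase a) x k
    by_contra hneg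
    push Not at hneg
    generalize esymmOn (S.erase a) k x = A at *
    generalize esymmOn (S.erase a) (k+1) x = B at *
    generalize esymmOn (S.erase a) (k+2) x = D at *
    have e1 : 0 < A * (D + x a * B) := mul_pos h0 h2
    have e2 : 0 ≤ (-B) * (B + x a * A) := mul_nonneg (by linarith) h1.le
    nlinarith

lemma term_eq {x f1 f0 E : ℝ} (hE : E = f1 + x * f0) (h0 : 0 < f0) (hEp : 0 < E) :
    x * f1 / E = x - x ^ 2 / (E / f0) := by
  have : f1 = E - x * f0 := by linarith
  rw [this]
  field_simp

lemma q_eq {n : ℕ} (S : Finset (Fin n)) (k : ℕ) (x : Fin n → ℝ)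
    (hE : 0 < esymmOn S (k+1) x) (hf : ∀ i ∈ S, 0 < esymmOn (S.erase i) k x) :
    ((k:ℝ)+2) * (esymmOn S (k+2) x / esymmOn S (k+1) x)
      = ∑ i ∈ S, (x i - x i ^ 2 / (esymmOn S (k+1) x / esymmOn (S.erase i) k x)) := by
  have h := esymmOn_euler x S (k+1)
  push_cast at h
  have h' : ((k:ℝ)+2) * esymmOn S (k+2) x = ∑ i ∈ S, x i * esymmOn (S.erase i) (k+1) x := by
    rw [h]; ring
  rw [← mul_div_assoc, h', Finset.sum_div]
  apply Finset.sum_congr rfl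
  intro i hi
  exact term_eq (esymmOn_erase S i hi k x) (hf i hi) hE

lemma sq_div_super {a b A B D : ℝ} (hA : 0 < A) (hB : 0 < B) (hD : A + B ≤ D) :
    (a + b) ^ 2 / D ≤ a ^ 2 / A + b ^ 2 / B := by
  calc (a + b) ^ 2 / D ≤ (a+b)^2 / (A + B) := by gcongr
    _ ≤ a ^ 2 / A + b ^ 2 / B := by
      rw [div_add_div _ _ hA.ne' hB.ne', div_le_div_iff₀ (by positivity) (by positivity)]
      nlinarith [mul_nonneg (mul_pos hA hB).le (sq_nonneg (a * B - b * A)),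
        sq_nonneg (a * B - b * A)]

lemma superadd {n : ℕ} (k : ℕ) : ∀ (S : Finset (Fin n)) (x y : Fin n → ℝ),
    coneOn S (k+1) x → coneOn S (k+1) y →
    coneOn S (k+1) (x+y) ∧
    esymmOn S (k+1) x / esymmOn S k x + esymmOn S (k+1) y / esymmOn S k y
      ≤ esymmOn S (k+1) (x+y) / esymmOn S k (x+y) := by
  induction k with
  | zero =>
    intro S x y hx hy
    have hl : esymmOn S 1 (x+y) = esymmOn S 1 x + esymmOn S 1 y := by
      simp [esymmOn, Finset.powersetCard_one, Finset.sum_add_distrib]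
    refine ⟨?_, ?_⟩
    · intro j hj
      have hj' : j = 0 ∨ j = 1 := by omega
      rcases hj' with rfl | rfl
      · simp [esymmOn_zero]
      · rw [hl]; exact add_pos (hx 1 le_rfl) (hy 1 le_rfl)
    · simp [esymmOn_zero, hl]
  | succ k ih =>
    intro S x y hx hy
    have hc := (ih S x y (fun j hj => hx j (by omega)) (fun j hj => hy j (by omega))).1
    have hex : ∀ i ∈ S, coneOn (S.erase i) (k+1) x := fun i hi => coneOn_erase S i hi x _ hx
    have hey : ∀ i ∈ S, coneOn (S.erase i) (k+1) y := fun i hi => coneOn_erase S i hi y _ hy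
    have hexy := fun i hi => ih (S.erase i) x y (hex i hi) (hey i hi)
    have qx := q_eq S k x (hx _ (by omega)) (fun i hi => hex i hi k (by omega))
    have qy := q_eq S k y (hy _ (by omega)) (fun i hi => hey i hi k (by omega))
    have qxy := q_eq S k (x+y) (hc _ le_rfl) (fun i hi => (hexy i hi).1 k (by omega))
    have key : esymmOn S (k+2) x / esymmOn S (k+1) x + esymmOn S (k+2) y / esymmOn S (k+1) y
      ≤ esymmOn S (k+2) (x+y) / esymmOn S (k+1) (x+y) := by
      have hk : (0:ℝ) < (k:ℝ)+2 := by positivity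
      refine le_of_mul_le_mul_left ?_ hk
      rw [mul_add, qx, qy, qxy, ← Finset.sum_add_distrib]
      apply Finset.sum_le_sum
      intro i hi
      have p1 := hex i hi k (by omega)
      have p2 := hey i hi k (by omega)
      have p3 := (hexy i hi).1 k (by omega)
      have hD : ∀ z : Fin n → ℝ, 0 < esymmOn (S.erase i) k z →
          esymmOn S (k+1) z / esymmOn (S.erase i) k z
          = esymmOn (S.erase i) (k+1) z / esymmOn (S.erase i) k z + z i := by
        intro z hz
        rw [esymmOn_erase S i hi]
        field_simp
      have := sq_div_super (a := x i) (b := y i)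
        (A := esymmOn S (k+1) x / esymmOn (S.erase i) k x)
        (B := esymmOn S (k+1) y / esymmOn (S.erase i) k y)
        (D := esymmOn S (k+1) (x+y) / esymmOn (S.erase i) k (x+y))
        (div_pos (hx _ (by omega)) p1) (div_pos (hy _ (by omega)) p2)
        (by
          rw [hD _ p1, hD _ p2, hD _ p3, Pi.add_apply]
          linarith [(hexy i hi).2])
      rw [Pi.add_apply]
      linarith
    refine ⟨?_, key⟩
    intro j hj
    rcases Nat.lt_or_ge j (k+2) with hj' | hj'
    · exact hc j (by omega)
    obtain rfl : j = k+2 := by omega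
    have hpos := lt_of_lt_of_le (add_pos (div_pos (hx (k+2) le_rfl) (hx (k+1) (by omega)))
      (div_pos (hy (k+2) le_rfl) (hy (k+1) (by omega)))) key
    exact (div_pos_iff_of_pos_right (hc _ le_rfl)).1 hpos

lemma coneOn_smul {n : ℕ} (S : Finset (Fin n)) (k : ℕ) (t : ℝ) (ht : 0 < t) (x : Fin n → ℝ)
    (h : coneOn S k x) : coneOn S k (t • x) := by
  intro j hj
  rw [esymmOn_smul]
  exact mul_pos (pow_pos ht j) (h j hj)

lemma log_conc {n : ℕ} (S : Finset (Fin n)) (x y : Fin n → ℝ) (a b : ℝ) (ha : 0 < a) (hb : 0 < b)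
    (hab : a + b = 1) (k : ℕ) (hx : coneOn S k x) (hy : coneOn S k y) :
    coneOn S k (a • x + b • y) ∧
    a * Real.log (esymmOn S k x) + b * Real.log (esymmOn S k y)
      ≤ Real.log (esymmOn S k (a • x + b • y)) := by
  induction k with
  | zero =>
    refine ⟨?_, by simp [esymmOn_zero]⟩
    intro j hj
    obtain rfl : j = 0 := by omega
    simp [esymmOn_zero]
  | succ k ih =>
    obtain ⟨_, ih2⟩ := ih (fun j hj => hx j (by omega)) (fun j hj => hy j (by omega))
    obtain ⟨c, q⟩ := superadd k S (a • x) (b • y) (coneOn_smul S _ a ha x hx)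
      (coneOn_smul S _ b hb y hy)
    refine ⟨c, ?_⟩
    have x0 := hx k (by omega)
    have x1 := hx (k+1) le_rfl
    have y0 := hy k (by omega)
    have y1 := hy (k+1) le_rfl
    have z0 := c k (by omega)
    have z1 := c (k+1) le_rfl
    simp only [esymmOn_smul] at q
    have hs : ∀ t u v : ℝ, 0 < t → 0 < u → t^(k+1) * v / (t^k * u) = t * (v / u) := by
      intro t u v ht hu
      field_simp
      ring
    rw [hs a _ _ ha x0, hs b _ _ hb y0] at q
    have hl := strictConcaveOn_log_Ioi.concaveOn.2 (Set.mem_Ioi.2 (div_pos x1 x0))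
      (Set.mem_Ioi.2 (div_pos y1 y0)) ha.le hb.le hab
    simp only [smul_eq_mul] at hl
    have hm := Real.log_le_log (by have := div_pos x1 x0; have := div_pos y1 y0; positivity) q
    rw [Real.log_div z1.ne' z0.ne'] at hm
    rw [Real.log_div x1.ne' x0.ne', Real.log_div y1.ne' y0.ne'] at hl
    linarith

/-- `log σ_k` is concave on the Gårding cone `Γ_k` (which is convex). -/
theorem log_sigmaK_concave (n k : ℕ) (hk1 : 1 ≤ k) (hkn : k ≤ n) :
    ConcaveOn ℝ (GardingCone n k) (fun lam => Real.log (sigmaK n k lam)) := by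
  have hc : ∀ x, x ∈ GardingCone n k ↔ coneOn Finset.univ k x := by
    intro x
    constructor
    · intro h j hj
      rcases Nat.eq_zero_or_pos j with rfl | h0
      · simp [esymmOn_zero]
      · exact h j h0 hj
    · intro h j _ hj
      exact h j hj
  have hne : ∀ x ∈ GardingCone n k, ∀ y ∈ GardingCone n k, ∀ a b : ℝ, 0 ≤ a → 0 ≤ b →
      a + b = 1 → a • x + b • y ∈ GardingCone n k ∧
      a * Real.log (sigmaK n k x) + b * Real.log (sigmaK n k y)
        ≤ Real.log (sigmaK n k (a • x + b • y)) := by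
    intro x hx y hy a b ha hb hab
    rcases ha.eq_or_lt with rfl | ha'
    · obtain rfl : b = 1 := by linarith
      simpa using hy
    rcases hb.eq_or_lt with rfl | hb'
    · obtain rfl : a = 1 := by linarith
      simpa using hx
    have := log_conc Finset.univ x y a b ha' hb' hab k ((hc x).1 hx) ((hc y).1 hy)
    exact ⟨(hc _).2 this.1, this.2⟩
  refine ⟨?_, ?_⟩
  · intro x hx y hy a b ha hb hab
    exact (hne x hx y hy a b ha hb hab).1
  · intro x hx y hy a b ha hb hab
    exact (hne x hx y hy a b ha hb hab).2
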